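/- (Secret key, guessing version.) For every positive integer c with c·|𝒦| ≤ |𝒨|, there is a {0,1}-valued choice of Alice's encoder (a conditional PMF P(M = m | X = x, Y = y, K = k)) for which Bob's guessing ambiguity satisfies 𝒜_B^g < 1 + 2^{ρ(H_{1/(1+ρ)}(X|Y) − log(c·|𝒦|) + 1)} and Eve's ambiguity satisfies 𝒜_E ≥ (1 + ln|𝒳|)^{−ρ} · 2^{ρ(H_{1/(1+ρ)}(X|Y) − log c)}. Conversely, for every choice of Alice's encoder, 𝒜_B^g ≥ max( (1 + ln|𝒳|)^{−ρ} · 2^{ρ(H_{1/(1+ρ)}(X|Y) − log|𝒨|)}, 1 ) and 𝒜_E ≤ min( |𝒦|^ρ · 𝒜_B^g, 2^{ρ H_{1/(1+ρ)}(X|Y)} ). -/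

import Mathlib

open scoped BigOperators

noncomputable section

/-- `G` is a guessing function for `X` given side information in `V`:
for every `v`, `G v` is a bijection from `X` onto `{1, …, |X|}`. -/
def IsGuess {X V : Type*} [Fintype X] (G : V → X → ℕ) : Prop :=
  ∀ v : V, Set.BijOn (G v) Set.univ (Set.Icc 1 (Fintype.card X))

/-- The conditional Rényi entropy `H_α(X|Y)` (base 2) of order `α = 1/(1+ρ)`. -/
def condRenyi {X Y : Type*} [Fintype X] [Fintype Y] (ρ : ℝ) (p : X → Y → ℝ) : ℝ :=
  ((1 / (1 + ρ)) / (1 - 1 / (1 + ρ))) *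
    Real.logb 2 (∑ y : Y, (∑ x : X, p x y ^ (1 / (1 + ρ))) ^ (1 / (1 / (1 + ρ))))

/-- Bob's guessing ambiguity `𝒜_B^g` in the secret-key scenario: Bob sees `(Y, K, M)`,
where the key `K` is independent of `(X,Y)` and uniform over `𝒦`. -/
def bobGuessAmbSK {𝒳 𝒴 𝒦 𝒨 : Type*} [Fintype 𝒳] [Fintype 𝒴] [Fintype 𝒦] [Fintype 𝒨]
    (ρ : ℝ) (p : 𝒳 → 𝒴 → ℝ) (e : 𝒳 → 𝒴 → 𝒦 → 𝒨 → ℝ) : ℝ :=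
  sInf {r : ℝ | ∃ G : 𝒴 × 𝒦 × 𝒨 → 𝒳 → ℕ, IsGuess G ∧
    r = ∑ x : 𝒳, ∑ y : 𝒴, ∑ k : 𝒦, ∑ m : 𝒨,
      p x y * (Fintype.card 𝒦 : ℝ)⁻¹ * e x y k m * (G (y, k, m) x : ℝ) ^ ρ}

/-- Bob's list ambiguity `𝒜_B^l` in the secret-key scenario. -/
def bobListAmbSK {𝒳 𝒴 𝒦 𝒨 : Type*} [Fintype 𝒳] [Fintype 𝒴] [Fintype 𝒦] [Fintype 𝒨]
    (ρ : ℝ) (p : 𝒳 → 𝒴 → ℝ) (e : 𝒳 → 𝒴 → 𝒦 → 𝒨 → ℝ) : ℝ :=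
  ∑ x : 𝒳, ∑ y : 𝒴, ∑ k : 𝒦, ∑ m : 𝒨,
    p x y * (Fintype.card 𝒦 : ℝ)⁻¹ * e x y k m *
      (((Finset.univ.filter fun x' : 𝒳 => 0 < p x' y * e x' y k m).card : ℝ)) ^ ρ

/-- Eve's ambiguity `𝒜_E` in the secret-key scenario: Eve sees only `(Y, M)`. -/
def eveAmbSK {𝒳 𝒴 𝒦 𝒨 : Type*} [Fintype 𝒳] [Fintype 𝒴] [Fintype 𝒦] [Fintype 𝒨]
    (ρ : ℝ) (p : 𝒳 → 𝒴 → ℝ) (e : 𝒳 → 𝒴 → 𝒦 → 𝒨 → ℝ) : ℝ :=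
  sInf {r : ℝ | ∃ G : 𝒴 × 𝒨 → 𝒳 → ℕ, IsGuess G ∧
    r = ∑ x : 𝒳, ∑ y : 𝒴, ∑ k : 𝒦, ∑ m : 𝒨,
      p x y * (Fintype.card 𝒦 : ℝ)⁻¹ * e x y k m * (G (y, m) x : ℝ) ^ ρ}

/-- The `(1+ρ)`-th power of the `1/(1+ρ)`-quasinorm of `p`, which governs Arikan's bounds on the
`ρ`-th moment of the number of guesses. -/
def guessMoment {X : Type*} [Fintype X] (ρ : ℝ) (p : X → ℝ) : ℝ :=
  (∑ x, p x ^ (1 / (1 + ρ))) ^ (1 + ρ)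

lemma guessMoment_nonneg {X : Type*} [Fintype X] (ρ : ℝ) {p : X → ℝ} (hp : ∀ x, 0 ≤ p x) :
    0 ≤ guessMoment ρ p :=
  Real.rpow_nonneg (Finset.sum_nonneg fun x _ => Real.rpow_nonneg (hp x) _) _

lemma sum_guessMoment_pos {X Y : Type*} [Fintype X] [Fintype Y] {ρ : ℝ} {p : X → Y → ℝ}
    (hp0 : ∀ x y, 0 ≤ p x y) (hp1 : ∑ x, ∑ y, p x y = 1) :
    0 < ∑ y, guessMoment ρ (fun x => p x y) := by
  have h : ∃ x y, p x y ≠ 0 := by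
    by_contra! h
    simp [h] at hp1
  obtain ⟨x, y, hxy⟩ := h
  have hpos : 0 < p x y := lt_of_le_of_ne (hp0 x y) (Ne.symm hxy)
  refine Finset.sum_pos' (fun y _ => guessMoment_nonneg ρ fun x => hp0 x y)
    ⟨y, Finset.mem_univ _, ?_⟩
  exact Real.rpow_pos_of_pos (Finset.sum_pos' (fun x _ => Real.rpow_nonneg (hp0 x y) _)
    ⟨x, Finset.mem_univ _, Real.rpow_pos_of_pos hpos _⟩) _

lemma two_rpow_mul_condRenyi_add {X Y : Type*} [Fintype X] [Fintype Y] {ρ : ℝ} (hρ : 0 < ρ)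
    {p : X → Y → ℝ} (hp0 : ∀ x y, 0 ≤ p x y) (hp1 : ∑ x, ∑ y, p x y = 1) (t : ℝ) :
    (2 : ℝ) ^ (ρ * (condRenyi ρ p + t)) =
      (∑ y, guessMoment ρ (fun x => p x y)) * ((2 : ℝ) ^ t) ^ ρ := by
  have hc : ρ * ((1 / (1 + ρ)) / (1 - 1 / (1 + ρ))) = 1 := by
    have : (1 : ℝ) + ρ ≠ 0 := by positivity
    have h2 : (1 : ℝ) - 1 / (1 + ρ) = ρ / (1 + ρ) := by field_simp; ring
    rw [h2]
    field_simp
  have hZ := sum_guessMoment_pos (ρ := ρ) hp0 hp1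
  rw [mul_add, Real.rpow_add two_pos, mul_comm ρ t, Real.rpow_mul two_pos.le t]
  congr 1
  rw [condRenyi, ← mul_assoc, hc, one_mul, one_div_one_div]
  exact Real.rpow_logb two_pos (by norm_num) hZ

lemma two_rpow_mul_condRenyi_sub_logb {X Y : Type*} [Fintype X] [Fintype Y] {ρ : ℝ} (hρ : 0 < ρ)
    {p : X → Y → ℝ} (hp0 : ∀ x y, 0 ≤ p x y) (hp1 : ∑ x, ∑ y, p x y = 1) {n : ℕ} (hn : 0 < n) :
    (2 : ℝ) ^ (ρ * (condRenyi ρ p - Real.logb 2 n)) =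
      (∑ y, guessMoment ρ (fun x => p x y)) * (n : ℝ) ^ (-ρ) := by
  have hn' : (0 : ℝ) < n := by exact_mod_cast hn
  rw [sub_eq_add_neg, two_rpow_mul_condRenyi_add hρ hp0 hp1, Real.rpow_neg two_pos.le,
    Real.rpow_logb two_pos (by norm_num) hn', Real.inv_rpow hn'.le, Real.rpow_neg hn'.le]

/-- Hölder's inequality behind Arikan's lower bound. -/
lemma guessMoment_le_mul {X : Type*} [Fintype X] {ρ : ℝ} (hρ : 0 < ρ) {p g : X → ℝ}
    (hp : ∀ x, 0 ≤ p x) (hg : ∀ x, 0 < g x) :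
    guessMoment ρ p ≤ (∑ x, p x * g x ^ ρ) * (∑ x, (g x)⁻¹) ^ ρ := by
  have h1 : (0 : ℝ) < 1 + ρ := by positivity
  have hpg : ∀ x, 0 ≤ p x * g x ^ ρ := fun x => mul_nonneg (hp x) (Real.rpow_nonneg (hg x).le _)
  have hpq : (1 + ρ).HolderConjugate ((1 + ρ) / ρ) := by
    rw [Real.holderConjugate_iff]
    exact ⟨by linarith, by field_simp⟩
  have key := Real.inner_le_Lp_mul_Lq_of_nonneg Finset.univ hpq
    (f := fun x => (p x * g x ^ ρ) ^ (1 / (1 + ρ))) (g := fun x => (g x)⁻¹ ^ (ρ / (1 + ρ)))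
    (fun x _ => Real.rpow_nonneg (hpg x) _)
    (fun x _ => Real.rpow_nonneg (inv_pos.2 (hg x)).le _)
  have e1 : ∀ x, (p x * g x ^ ρ) ^ (1 / (1 + ρ)) * (g x)⁻¹ ^ (ρ / (1 + ρ)) =
      p x ^ (1 / (1 + ρ)) := fun x => by
    rw [Real.mul_rpow (hp x) (Real.rpow_nonneg (hg x).le _), ← Real.rpow_mul (hg x).le,
      Real.inv_rpow (hg x).le, mul_one_div, mul_assoc,
      mul_inv_cancel₀ (Real.rpow_pos_of_pos (hg x) _).ne', mul_one]
  have e2 : ∀ x, ((p x * g x ^ ρ) ^ (1 / (1 + ρ))) ^ (1 + ρ) = p x * g x ^ ρ := fun x => by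
    rw [← Real.rpow_mul (hpg x), one_div_mul_cancel h1.ne', Real.rpow_one]
  have e3 : ∀ x, ((g x)⁻¹ ^ (ρ / (1 + ρ))) ^ ((1 + ρ) / ρ) = (g x)⁻¹ := fun x => by
    rw [← Real.rpow_mul (inv_pos.2 (hg x)).le,
      show ρ / (1 + ρ) * ((1 + ρ) / ρ) = 1 by field_simp, Real.rpow_one]
  simp only [e1, e2, e3] at key
  have hA : 0 ≤ ∑ x, p x * g x ^ ρ := Finset.sum_nonneg fun x _ => hpg x
  have hB : 0 ≤ ∑ x, (g x)⁻¹ := Finset.sum_nonneg fun x _ => (inv_pos.2 (hg x)).le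
  calc guessMoment ρ p
      ≤ ((∑ x, p x * g x ^ ρ) ^ (1 / (1 + ρ)) * (∑ x, (g x)⁻¹) ^ (1 / ((1 + ρ) / ρ))) ^ (1 + ρ) :=
        Real.rpow_le_rpow (Finset.sum_nonneg fun x _ => Real.rpow_nonneg (hp x) _) key h1.le
    _ = _ := by
        rw [Real.mul_rpow (Real.rpow_nonneg hA _) (Real.rpow_nonneg hB _), ← Real.rpow_mul hA,
          ← Real.rpow_mul hB, one_div_mul_cancel h1.ne', Real.rpow_one, one_div_div,
          div_mul_cancel₀ _ h1.ne']

lemma sum_inv_le_one_add_log {X : Type*} [Fintype X] {g : X → ℕ}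
    (hg : Set.BijOn g Set.univ (Set.Icc 1 (Fintype.card X))) :
    ∑ x, (g x : ℝ)⁻¹ ≤ 1 + Real.log (Fintype.card X) := by
  refine le_trans (le_of_eq ?_) (harmonic_le_one_add_log (Fintype.card X))
  rw [harmonic_eq_sum_Icc]
  push_cast
  refine Finset.sum_bij (fun x _ => g x) (fun x _ => ?_) (fun x _ y _ h => ?_) (fun b hb => ?_)
    (fun _ _ => rfl)
  · exact Finset.mem_Icc.2 (hg.mapsTo (Set.mem_univ x))
  · exact hg.injOn (Set.mem_univ x) (Set.mem_univ y) h
  · obtain ⟨x, -, hx⟩ := hg.surjOn (Finset.mem_Icc.1 hb)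
    exact ⟨x, Finset.mem_univ x, hx⟩

/-- Arikan's lower bound when the guesser is told a hint `h x` taking at most `|ι|` values. -/
lemma guessMoment_le_of_hint {X ι : Type*} [Fintype X] [Fintype ι] {ρ : ℝ} (hρ : 0 < ρ)
    {p : X → ℝ} (hp : ∀ x, 0 ≤ p x) {g : ι → X → ℕ} (hg : IsGuess g) (h : X → ι) :
    (1 + Real.log (Fintype.card X)) ^ (-ρ) * (guessMoment ρ p * (Fintype.card ι : ℝ) ^ (-ρ)) ≤
      ∑ x, p x * (g (h x) x : ℝ) ^ ρ := by
  rcases isEmpty_or_nonempty X with hX | ⟨⟨x₀⟩⟩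
  · have : (1 : ℝ) + ρ ≠ 0 := by positivity
    simp [guessMoment, Real.zero_rpow this]
  have hι : (0 : ℝ) < Fintype.card ι := by
    exact_mod_cast Fintype.card_pos_iff.2 ⟨h x₀⟩
  have hX : (1 : ℝ) ≤ Fintype.card X := by
    exact_mod_cast Nat.succ_le_of_lt (Fintype.card_pos_iff.2 ⟨x₀⟩)
  have hL : 0 < 1 + Real.log (Fintype.card X) := by linarith [Real.log_nonneg hX]
  have hpos : ∀ i x, (0 : ℝ) < g i x := fun i x => by
    exact_mod_cast Nat.lt_of_lt_of_le one_pos ((hg i).mapsTo (Set.mem_univ x)).1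
  have hsum : ∑ x, (g (h x) x : ℝ)⁻¹ ≤ Fintype.card ι * (1 + Real.log (Fintype.card X)) :=
    calc ∑ x, (g (h x) x : ℝ)⁻¹ ≤ ∑ x, ∑ i, (g i x : ℝ)⁻¹ :=
          Finset.sum_le_sum fun x _ => Finset.single_le_sum (f := fun i => (g i x : ℝ)⁻¹)
            (fun i _ => (inv_pos.2 (hpos i x)).le) (Finset.mem_univ _)
      _ = ∑ i, ∑ x, (g i x : ℝ)⁻¹ := Finset.sum_comm
      _ ≤ ∑ _i : ι, (1 + Real.log (Fintype.card X)) :=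
          Finset.sum_le_sum fun i _ => sum_inv_le_one_add_log (hg i)
      _ = _ := by rw [Finset.sum_const, Finset.card_univ, nsmul_eq_mul]
  have hA : 0 ≤ ∑ x, p x * (g (h x) x : ℝ) ^ ρ :=
    Finset.sum_nonneg fun x _ => mul_nonneg (hp x) (Real.rpow_nonneg (hpos _ x).le _)
  have key : guessMoment ρ p ≤ (∑ x, p x * (g (h x) x : ℝ) ^ ρ) *
      ((Fintype.card ι : ℝ) ^ ρ * (1 + Real.log (Fintype.card X)) ^ ρ) := by
    rw [← Real.mul_rpow hι.le hL.le]
    exact (guessMoment_le_mul hρ hp fun x => hpos (h x) x).trans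
      (mul_le_mul_of_nonneg_left (Real.rpow_le_rpow
        (Finset.sum_nonneg fun x _ => (inv_pos.2 (hpos _ x)).le) hsum hρ.le) hA)
  have h1 := Real.rpow_pos_of_pos hι ρ
  have h2 := Real.rpow_pos_of_pos hL ρ
  rw [Real.rpow_neg hL.le, Real.rpow_neg hι.le, inv_mul_le_iff₀ h2, mul_inv_le_iff₀ h1]
  linarith

/-- Guessing in increasing order of `w`. -/
lemma exists_bijOn_le_card {X α : Type*} [Fintype X] [LinearOrder α] (w : X → α) :
    ∃ g : X → ℕ, Set.BijOn g Set.univ (Set.Icc 1 (Fintype.card X)) ∧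
      ∀ x, g x ≤ (Finset.univ.filter fun x' => w x' ≤ w x).card := by
  let φ := Fintype.equivFin X
  let σ := Tuple.sort (w ∘ φ.symm)
  have hσ : Monotone ((w ∘ φ.symm) ∘ σ) := Tuple.monotone_sort _
  let τ : X ≃ Fin (Fintype.card X) := φ.trans σ.symm
  have hτ : ∀ i, ((w ∘ φ.symm) ∘ σ) i = w (τ.symm i) := fun i => rfl
  refine ⟨fun x => τ x + 1, ⟨fun x _ => ⟨Nat.succ_pos _, (τ x).isLt⟩, fun x _ y _ hxy => ?_,
    fun n hn => ?_⟩, fun x => ?_⟩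
  · exact τ.injective (Fin.ext (Nat.succ_injective hxy))
  · have hn1 := hn.1
    have hn2 := hn.2
    exact ⟨τ.symm ⟨n - 1, by omega⟩, Set.mem_univ _, by simp; omega⟩
  · have hsub : (Finset.Iic (τ x)).map τ.symm.toEmbedding ⊆
        Finset.univ.filter fun x' => w x' ≤ w x := by
      intro x' hx'
      obtain ⟨i, hi, rfl⟩ := Finset.mem_map.1 hx'
      have := hσ (Finset.mem_Iic.1 hi)
      simp only [hτ, Equiv.symm_apply_apply] at this
      simpa using this
    simpa using Finset.card_le_card hsub

/-- Arikan's upper bound, attained by guessing in decreasing order of probability. -/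
lemma exists_bijOn_sum_mul_rpow_le_guessMoment {X : Type*} [Fintype X] {ρ : ℝ} (hρ : 0 < ρ)
    {p : X → ℝ} (hp : ∀ x, 0 ≤ p x) :
    ∃ g : X → ℕ, Set.BijOn g Set.univ (Set.Icc 1 (Fintype.card X)) ∧
      ∑ x, p x * (g x : ℝ) ^ ρ ≤ guessMoment ρ p := by
  obtain ⟨g, hg, hle⟩ := exists_bijOn_le_card fun x => -p x
  refine ⟨g, hg, ?_⟩
  have h1 : (0 : ℝ) < 1 + ρ := by positivity
  have hS : 0 ≤ ∑ x, p x ^ (1 / (1 + ρ)) :=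
    Finset.sum_nonneg fun x _ => Real.rpow_nonneg (hp x) _
  rw [guessMoment, Real.rpow_add' hS h1.ne', Real.rpow_one, Finset.sum_mul]
  refine Finset.sum_le_sum fun x _ => ?_
  rcases (hp x).eq_or_lt with h0 | hpos
  · rw [← h0, zero_mul]
    exact mul_nonneg (Real.rpow_nonneg le_rfl _) (Real.rpow_nonneg hS _)
  have hq := Real.rpow_pos_of_pos hpos (1 / (1 + ρ))
  have hbound : p x ^ (1 / (1 + ρ)) * g x ≤ ∑ x', p x' ^ (1 / (1 + ρ)) :=
    calc p x ^ (1 / (1 + ρ)) * g x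
        ≤ p x ^ (1 / (1 + ρ)) * (Finset.univ.filter fun x' => -p x' ≤ -p x).card := by
          gcongr
          exact hle x
      _ = ∑ _x' ∈ Finset.univ.filter (fun x' => -p x' ≤ -p x), p x ^ (1 / (1 + ρ)) := by
          rw [Finset.sum_const, nsmul_eq_mul, mul_comm]
      _ ≤ ∑ x' ∈ Finset.univ.filter (fun x' => -p x' ≤ -p x), p x' ^ (1 / (1 + ρ)) :=
          Finset.sum_le_sum fun x' hx' => Real.rpow_le_rpow (hp x)
            (neg_le_neg_iff.1 (Finset.mem_filter.1 hx').2) (by positivity)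
      _ ≤ _ := Finset.sum_le_sum_of_subset_of_nonneg (Finset.filter_subset _ _)
          fun x' _ _ => Real.rpow_nonneg (hp x') _
  have hexp : p x = p x ^ (1 / (1 + ρ)) * (p x ^ (1 / (1 + ρ))) ^ ρ := by
    rw [← Real.rpow_mul hpos.le, ← Real.rpow_add hpos,
      show 1 / (1 + ρ) + 1 / (1 + ρ) * ρ = 1 by field_simp, Real.rpow_one]
  calc p x * (g x : ℝ) ^ ρ
      = p x ^ (1 / (1 + ρ)) * (p x ^ (1 / (1 + ρ)) * g x) ^ ρ := by
        conv_lhs => rw [hexp]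
        rw [Real.mul_rpow hq.le (Nat.cast_nonneg _), mul_assoc]
    _ ≤ _ := by gcongr

/-- A guesser who does not know `k` loses at most a factor `|𝒦|` against one who does. -/
lemma exists_bijOn_le_card_mul {X K : Type*} [Fintype X] [Fintype K] [Nonempty K]
    {g : K → X → ℕ} (hg : IsGuess g) :
    ∃ g' : X → ℕ, Set.BijOn g' Set.univ (Set.Icc 1 (Fintype.card X)) ∧
      ∀ k x, g' x ≤ Fintype.card K * g k x := by
  classical
  choose κ hκ using fun x => Finite.exists_min fun k => g k x
  obtain ⟨g', hg', hle⟩ := exists_bijOn_le_card fun x => g (κ x) x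
  refine ⟨g', hg', fun k x => (hle x).trans ?_⟩
  have hsub : (Finset.univ.filter fun x' => g (κ x') x' ≤ g (κ x) x) ⊆
      Finset.univ.biUnion fun j : K => Finset.univ.filter fun x' => g j x' ≤ g k x := by
    intro x' hx'
    simp only [Finset.mem_filter, Finset.mem_univ, true_and] at hx'
    simpa using ⟨κ x', hx'.trans (hκ x k)⟩
  refine (Finset.card_le_card hsub).trans (Finset.card_biUnion_le_card_mul _ _ _ fun j _ => ?_)
  calc (Finset.univ.filter fun x' => g j x' ≤ g k x).card
      ≤ (Finset.Icc 1 (g k x)).card := by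
        refine Finset.card_le_card_of_injOn (g j) (fun x' hx' => ?_)
          fun a _ b _ => (hg j).injOn (Set.mem_univ a) (Set.mem_univ b)
        simpa using ⟨((hg j).mapsTo (Set.mem_univ x')).1, by simpa using hx'⟩
    _ = g k x := by simp

/-- Knowing the residue modulo `n` of the rank `g x`, the guesser needs about `g x / n` guesses. -/
lemma exists_bijOn_le_div_add_one {X ι : Type*} [Fintype X] {g : X → ℕ}
    (hg : Set.BijOn g Set.univ (Set.Icc 1 (Fintype.card X))) (n : ℕ) {h : X → ι}
    (hh : ∀ x x', h x = h x' → (g x - 1) % n = (g x' - 1) % n) (i : ι) :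
    ∃ g' : X → ℕ, Set.BijOn g' Set.univ (Set.Icc 1 (Fintype.card X)) ∧
      ∀ x, h x = i → g' x ≤ (g x - 1) / n + 1 := by
  classical
  obtain ⟨g', hg', hle⟩ :=
    exists_bijOn_le_card fun x => if h x = i then g x else Fintype.card X + 1
  refine ⟨g', hg', fun x hx => (hle x).trans ?_⟩
  have hmem : ∀ x, 1 ≤ g x ∧ g x ≤ Fintype.card X := fun x => hg.mapsTo (Set.mem_univ x)
  have hcond : ∀ x' ∈ Finset.univ.filter (fun x' => (if h x' = i then g x' else
      Fintype.card X + 1) ≤ if h x = i then g x else Fintype.card X + 1),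
      h x' = i ∧ g x' ≤ g x := by
    intro x' hx'
    have h1 := (Finset.mem_filter.1 hx').2
    have h2 := (hmem x).2
    rw [if_pos hx] at h1
    split_ifs at h1 with h3
    · exact ⟨h3, h1⟩
    · omega
  rw [← Finset.card_range ((g x - 1) / n + 1)]
  refine Finset.card_le_card_of_injOn (fun x' => (g x' - 1) / n) (fun x' hx' => ?_)
    fun a ha b hb hab => hg.injOn (Set.mem_univ a) (Set.mem_univ b) ?_
  · have := (hcond x' hx').2
    simp only [Finset.coe_range, Set.mem_Iio]
    exact Nat.lt_succ_of_le (Nat.div_le_div_right (by omega))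
  · have hmod := hh a b ((hcond a ha).1.trans (hcond b hb).1.symm)
    have ea := Nat.div_add_mod (g a - 1) n
    have eb := Nat.div_add_mod (g b - 1) n
    simp only at hab
    rw [hab, hmod, eb] at ea
    have := (hmem a).1
    have := (hmem b).1
    omega

lemma div_add_one_rpow_lt {ρ : ℝ} (hρ : 0 < ρ) {n g : ℕ} (hn : 0 < n) (hg : 1 ≤ g) :
    (((g - 1) / n + 1 : ℕ) : ℝ) ^ ρ < 1 + (g : ℝ) ^ ρ * (2 * (n : ℝ)⁻¹) ^ ρ := by
  have hn' : (0 : ℝ) < n := by exact_mod_cast hn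
  have hg' : (0 : ℝ) < g := by exact_mod_cast hg
  rw [← Real.mul_rpow hg'.le (by positivity)]
  rcases lt_or_ge (g - 1) n with h | h
  · rw [Nat.div_eq_of_lt h]
    simp only [zero_add, Nat.cast_one, Real.one_rpow]
    linarith [Real.rpow_pos_of_pos (show 0 < (g : ℝ) * (2 * (n : ℝ)⁻¹) by positivity) ρ]
  · have hle : (((g - 1) / n + 1 : ℕ) : ℝ) ≤ g * (2 * (n : ℝ)⁻¹) := by
      have h1 : (g - 1) / n * n ≤ g - 1 := Nat.div_mul_le_self _ _
      have h2 : ((g - 1) / n + 1) * n ≤ 2 * g := by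
        rw [add_mul]
        omega
      have h3 : (((g - 1) / n + 1 : ℕ) : ℝ) * n ≤ 2 * g := by exact_mod_cast h2
      rw [show (g : ℝ) * (2 * (n : ℝ)⁻¹) = 2 * g / n by ring, le_div_iff₀ hn']
      exact h3
    linarith [Real.rpow_le_rpow (Nat.cast_nonneg _) hle hρ.le]

lemma exists_isGuess (X V : Type*) [Fintype X] : ∃ G : V → X → ℕ, IsGuess G := by
  obtain ⟨g, hg, -⟩ := exists_bijOn_le_card fun _ : X => (0 : ℕ)
  exact ⟨fun _ => g, fun _ => hg⟩

/-- The encoder that deterministically sends `f x y k`. -/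
def detEncoder {𝒳 𝒴 𝒦 𝒨 : Type*} [DecidableEq 𝒨] (f : 𝒳 → 𝒴 → 𝒦 → 𝒨) : 𝒳 → 𝒴 → 𝒦 → 𝒨 → ℝ :=
  fun x y k m => if f x y k = m then 1 else 0

lemma detEncoder_nonneg {𝒳 𝒴 𝒦 𝒨 : Type*} [DecidableEq 𝒨] (f : 𝒳 → 𝒴 → 𝒦 → 𝒨)
    (x : 𝒳) (y : 𝒴) (k : 𝒦) (m : 𝒨) :
    0 ≤ detEncoder f x y k m := by
  unfold detEncoder
  split_ifs <;> norm_num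

lemma sum_detEncoder_mul {𝒳 𝒴 𝒦 𝒨 : Type*} [Fintype 𝒨] [DecidableEq 𝒨]
    (f : 𝒳 → 𝒴 → 𝒦 → 𝒨) (x : 𝒳) (y : 𝒴) (k : 𝒦)
    (a : ℝ) (b : 𝒨 → ℝ) : ∑ m, a * detEncoder f x y k m * b m = a * b (f x y k) := by
  simp [detEncoder]

section Ambiguity

variable {𝒳 𝒴 𝒦 𝒨 : Type*} [Fintype 𝒳] [Fintype 𝒴] [Fintype 𝒦] [Fintype 𝒨]
  {ρ : ℝ} {p : 𝒳 → 𝒴 → ℝ} {e : 𝒳 → 𝒴 → 𝒦 → 𝒨 → ℝ}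

lemma bobGuessAmbSK_le (hp0 : ∀ x y, 0 ≤ p x y) (he : ∀ x y k m, 0 ≤ e x y k m)
    {G : 𝒴 × 𝒦 × 𝒨 → 𝒳 → ℕ} (hG : IsGuess G) :
    bobGuessAmbSK ρ p e ≤ ∑ x, ∑ y, ∑ k, ∑ m,
      p x y * (Fintype.card 𝒦 : ℝ)⁻¹ * e x y k m * (G (y, k, m) x : ℝ) ^ ρ := by
  refine csInf_le ⟨0, ?_⟩ ⟨G, hG, rfl⟩
  rintro r ⟨G, -, rfl⟩
  exact Finset.sum_nonneg fun x _ => Finset.sum_nonneg fun y _ => Finset.sum_nonneg fun k _ =>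
    Finset.sum_nonneg fun m _ => mul_nonneg (mul_nonneg (mul_nonneg (hp0 x y) (by positivity))
      (he x y k m)) (Real.rpow_nonneg (Nat.cast_nonneg _) _)

lemma eveAmbSK_le (hp0 : ∀ x y, 0 ≤ p x y) (he : ∀ x y k m, 0 ≤ e x y k m)
    {G : 𝒴 × 𝒨 → 𝒳 → ℕ} (hG : IsGuess G) :
    eveAmbSK ρ p e ≤ ∑ x, ∑ y, ∑ k, ∑ m,
      p x y * (Fintype.card 𝒦 : ℝ)⁻¹ * e x y k m * (G (y, m) x : ℝ) ^ ρ := by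
  refine csInf_le ⟨0, ?_⟩ ⟨G, hG, rfl⟩
  rintro r ⟨G, -, rfl⟩
  exact Finset.sum_nonneg fun x _ => Finset.sum_nonneg fun y _ => Finset.sum_nonneg fun k _ =>
    Finset.sum_nonneg fun m _ => mul_nonneg (mul_nonneg (mul_nonneg (hp0 x y) (by positivity))
      (he x y k m)) (Real.rpow_nonneg (Nat.cast_nonneg _) _)

lemma le_bobGuessAmbSK {b : ℝ}
    (h : ∀ G : 𝒴 × 𝒦 × 𝒨 → 𝒳 → ℕ, IsGuess G → b ≤ ∑ x, ∑ y, ∑ k, ∑ m,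
      p x y * (Fintype.card 𝒦 : ℝ)⁻¹ * e x y k m * (G (y, k, m) x : ℝ) ^ ρ) :
    b ≤ bobGuessAmbSK ρ p e := by
  obtain ⟨G, hG⟩ := exists_isGuess 𝒳 (𝒴 × 𝒦 × 𝒨)
  refine le_csInf ⟨_, G, hG, rfl⟩ ?_
  rintro r ⟨G, hG, rfl⟩
  exact h G hG

lemma le_eveAmbSK {b : ℝ}
    (h : ∀ G : 𝒴 × 𝒨 → 𝒳 → ℕ, IsGuess G → b ≤ ∑ x, ∑ y, ∑ k, ∑ m,
      p x y * (Fintype.card 𝒦 : ℝ)⁻¹ * e x y k m * (G (y, m) x : ℝ) ^ ρ) :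
    b ≤ eveAmbSK ρ p e := by
  obtain ⟨G, hG⟩ := exists_isGuess 𝒳 (𝒴 × 𝒨)
  refine le_csInf ⟨_, G, hG, rfl⟩ ?_
  rintro r ⟨G, hG, rfl⟩
  exact h G hG

lemma sum_key_hint_const [Nonempty 𝒦] (he1 : ∀ x y k, ∑ m, e x y k m = 1) (a : 𝒳 → 𝒴 → ℝ) :
    ∑ x, ∑ y, ∑ k, ∑ m, p x y * (Fintype.card 𝒦 : ℝ)⁻¹ * e x y k m * a x y =
      ∑ x, ∑ y, p x y * a x y := by
  have hK : (Fintype.card 𝒦 : ℝ) ≠ 0 := by exact_mod_cast Fintype.card_ne_zero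
  refine Finset.sum_congr rfl fun x _ => Finset.sum_congr rfl fun y _ => ?_
  simp only [← Finset.sum_mul, ← Finset.mul_sum, he1]
  rw [Finset.sum_const, Finset.card_univ, nsmul_eq_mul]
  field_simp

lemma one_le_bobGuessAmbSK [Nonempty 𝒦] (hρ : 0 < ρ) (hp0 : ∀ x y, 0 ≤ p x y)
    (hp1 : ∑ x, ∑ y, p x y = 1) (he : ∀ x y k m, 0 ≤ e x y k m)
    (he1 : ∀ x y k, ∑ m, e x y k m = 1) : 1 ≤ bobGuessAmbSK ρ p e := by
  refine le_bobGuessAmbSK fun G hG => ?_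
  have h := sum_key_hint_const (p := p) he1 fun _ _ => 1
  simp only [mul_one, hp1] at h
  rw [← h]
  refine Finset.sum_le_sum fun x _ => Finset.sum_le_sum fun y _ => Finset.sum_le_sum fun k _ =>
    Finset.sum_le_sum fun m _ => ?_
  refine le_mul_of_one_le_right (mul_nonneg (mul_nonneg (hp0 x y) (by positivity)) (he x y k m))
    (Real.one_le_rpow ?_ hρ.le)
  exact_mod_cast ((hG (y, k, m)).mapsTo (Set.mem_univ x)).1

lemma guessMoment_le_bobGuessAmbSK [Nonempty 𝒦] [Nonempty 𝒨] (hρ : 0 < ρ)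
    (hp0 : ∀ x y, 0 ≤ p x y) (he : ∀ x y k m, 0 ≤ e x y k m)
    (he1 : ∀ x y k, ∑ m, e x y k m = 1) :
    (1 + Real.log (Fintype.card 𝒳)) ^ (-ρ) *
      ((∑ y, guessMoment ρ (fun x => p x y)) * (Fintype.card 𝒨 : ℝ) ^ (-ρ)) ≤
      bobGuessAmbSK ρ p e := by
  have hK : (Fintype.card 𝒦 : ℝ) ≠ 0 := by exact_mod_cast Fintype.card_ne_zero
  refine le_bobGuessAmbSK fun G hG => ?_
  choose h hh using fun (y : 𝒴) (k : 𝒦) (x : 𝒳) => Finite.exists_min fun m => G (y, k, m) x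
  rw [Finset.sum_comm, Finset.sum_mul, Finset.mul_sum]
  refine Finset.sum_le_sum fun y _ => ?_
  rw [Finset.sum_comm]
  set b := (1 + Real.log (Fintype.card 𝒳)) ^ (-ρ) *
      (guessMoment ρ (fun x => p x y) * (Fintype.card 𝒨 : ℝ) ^ (-ρ))
  calc b = ∑ _k : 𝒦, (Fintype.card 𝒦 : ℝ)⁻¹ * b := by simp [hK]
    _ ≤ _ := Finset.sum_le_sum fun k _ => ?_
  calc (Fintype.card 𝒦 : ℝ)⁻¹ * b
      ≤ (Fintype.card 𝒦 : ℝ)⁻¹ * ∑ x, p x y * (G (y, k, h y k x) x : ℝ) ^ ρ := by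
        gcongr
        exact guessMoment_le_of_hint hρ (fun x => hp0 x y) (g := fun m => G (y, k, m))
          (fun m => hG (y, k, m)) (h y k)
    _ ≤ _ := by
        rw [Finset.mul_sum]
        refine Finset.sum_le_sum fun x _ => ?_
        calc (Fintype.card 𝒦 : ℝ)⁻¹ * (p x y * (G (y, k, h y k x) x : ℝ) ^ ρ)
            = ∑ m, p x y * (Fintype.card 𝒦 : ℝ)⁻¹ * e x y k m *
                (G (y, k, h y k x) x : ℝ) ^ ρ := by
              rw [← Finset.sum_mul, ← Finset.mul_sum, he1]
              ring
          _ ≤ _ := Finset.sum_le_sum fun m _ => by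
              have h1 := hp0 x y
              have h2 := he x y k m
              have h3 := hh y k x m
              gcongr

lemma eveAmbSK_le_guessMoment [Nonempty 𝒦] (hρ : 0 < ρ) (hp0 : ∀ x y, 0 ≤ p x y)
    (he : ∀ x y k m, 0 ≤ e x y k m) (he1 : ∀ x y k, ∑ m, e x y k m = 1) :
    eveAmbSK ρ p e ≤ ∑ y, guessMoment ρ (fun x => p x y) := by
  choose g hg hle using fun y =>
    exists_bijOn_sum_mul_rpow_le_guessMoment hρ (p := fun x => p x y) fun x => hp0 x y
  refine (eveAmbSK_le hp0 he (G := fun v => g v.1) fun v => hg v.1).trans ?_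
  rw [sum_key_hint_const he1 fun x y => (g y x : ℝ) ^ ρ, Finset.sum_comm]
  exact Finset.sum_le_sum fun y _ => hle y

lemma eveAmbSK_le_card_rpow_mul_bobGuessAmbSK [Nonempty 𝒦] (hρ : 0 < ρ)
    (hp0 : ∀ x y, 0 ≤ p x y) (he : ∀ x y k m, 0 ≤ e x y k m) :
    eveAmbSK ρ p e ≤ (Fintype.card 𝒦 : ℝ) ^ ρ * bobGuessAmbSK ρ p e := by
  have hK : (0 : ℝ) < Fintype.card 𝒦 := by exact_mod_cast Fintype.card_pos
  rw [← inv_mul_le_iff₀ (Real.rpow_pos_of_pos hK ρ)]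
  refine le_bobGuessAmbSK fun G hG => ?_
  rw [inv_mul_le_iff₀ (Real.rpow_pos_of_pos hK ρ)]
  choose g hg hle using fun v : 𝒴 × 𝒨 =>
    exists_bijOn_le_card_mul (g := fun k => G (v.1, k, v.2)) fun k => hG (v.1, k, v.2)
  refine (eveAmbSK_le hp0 he (G := g) hg).trans ?_
  simp only [Finset.mul_sum]
  refine Finset.sum_le_sum fun x _ => Finset.sum_le_sum fun y _ => Finset.sum_le_sum fun k _ =>
    Finset.sum_le_sum fun m _ => ?_
  have h1 : (g (y, m) x : ℝ) ≤ Fintype.card 𝒦 * G (y, k, m) x := by exact_mod_cast hle (y, m) k x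
  have h2 := Real.rpow_le_rpow (Nat.cast_nonneg _) h1 hρ.le
  rw [Real.mul_rpow hK.le (Nat.cast_nonneg _)] at h2
  have h3 : 0 ≤ p x y * (Fintype.card 𝒦 : ℝ)⁻¹ * e x y k m :=
    mul_nonneg (mul_nonneg (hp0 x y) (by positivity)) (he x y k m)
  calc _ ≤ _ := mul_le_mul_of_nonneg_left h2 h3
    _ = _ := by ring

/-- If, given the key, the message determines the residue modulo `n` of the rank of `x` in an
order of decreasing probability, then Bob's ambiguity is small. -/
lemma bobGuessAmbSK_detEncoder_lt [DecidableEq 𝒨] [Nonempty 𝒦] (hρ : 0 < ρ)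
    (hp0 : ∀ x y, 0 ≤ p x y) (hp1 : ∑ x, ∑ y, p x y = 1) {n : ℕ} (hn : 0 < n) {g : 𝒴 → 𝒳 → ℕ}
    (hg : IsGuess g)
    (hgle : ∀ y, ∑ x, p x y * (g y x : ℝ) ^ ρ ≤ guessMoment ρ (fun x => p x y))
    {f : 𝒳 → 𝒴 → 𝒦 → 𝒨}
    (hf : ∀ y k x x', f x y k = f x' y k → (g y x - 1) % n = (g y x' - 1) % n) :
    bobGuessAmbSK ρ p (detEncoder f) <
      1 + (∑ y, guessMoment ρ (fun x => p x y)) * (2 * (n : ℝ)⁻¹) ^ ρ := by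
  have hK : (Fintype.card 𝒦 : ℝ) ≠ 0 := by exact_mod_cast Fintype.card_ne_zero
  choose G hG hle using fun v : 𝒴 × 𝒦 × 𝒨 =>
    exists_bijOn_le_div_add_one (hg v.1) n (h := fun x => f x v.1 v.2.1) (hf v.1 v.2.1) v.2.2
  calc bobGuessAmbSK ρ p (detEncoder f)
      ≤ ∑ x, ∑ y, ∑ k, ∑ m, p x y * (Fintype.card 𝒦 : ℝ)⁻¹ * detEncoder f x y k m *
          (G (y, k, m) x : ℝ) ^ ρ := bobGuessAmbSK_le hp0 (detEncoder_nonneg f) hG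
    _ ≤ ∑ x, ∑ y, p x y * (((g y x - 1) / n + 1 : ℕ) : ℝ) ^ ρ := by
        refine Finset.sum_le_sum fun x _ => Finset.sum_le_sum fun y _ => ?_
        calc _ ≤ ∑ _k : 𝒦, p x y * (Fintype.card 𝒦 : ℝ)⁻¹ *
              (((g y x - 1) / n + 1 : ℕ) : ℝ) ^ ρ := by
              refine Finset.sum_le_sum fun k _ => ?_
              rw [sum_detEncoder_mul]
              refine mul_le_mul_of_nonneg_left (Real.rpow_le_rpow (Nat.cast_nonneg _) ?_ hρ.le)
                (mul_nonneg (hp0 x y) (by positivity))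
              exact_mod_cast hle (y, k, f x y k) x rfl
          _ = _ := by
              rw [Finset.sum_const, Finset.card_univ, nsmul_eq_mul]
              field_simp
    _ < ∑ x, ∑ y, p x y * (1 + (g y x : ℝ) ^ ρ * (2 * (n : ℝ)⁻¹) ^ ρ) := by
        have hlt := fun x y => div_add_one_rpow_lt hρ hn ((hg y).mapsTo (Set.mem_univ x)).1
        have h : ∃ x y, p x y ≠ 0 := by
          by_contra! h
          simp [h] at hp1
        obtain ⟨x, y, hxy⟩ := h
        refine Finset.sum_lt_sum (fun x _ => Finset.sum_le_sum fun y _ =>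
          mul_le_mul_of_nonneg_left (hlt x y).le (hp0 x y)) ⟨x, Finset.mem_univ x, ?_⟩
        exact Finset.sum_lt_sum (fun y _ => mul_le_mul_of_nonneg_left (hlt x y).le (hp0 x y))
          ⟨y, Finset.mem_univ y,
            mul_lt_mul_of_pos_left (hlt x y) ((hp0 x y).lt_of_ne (Ne.symm hxy))⟩
    _ = 1 + (∑ y, ∑ x, p x y * (g y x : ℝ) ^ ρ) * (2 * (n : ℝ)⁻¹) ^ ρ := by
        simp only [mul_add, mul_one, Finset.sum_add_distrib, hp1, ← mul_assoc, ← Finset.sum_mul]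
        rw [Finset.sum_comm]
    _ ≤ _ := by
        gcongr with y
        exact hgle y

/-- If part of the label is protected by a one-time pad, Eve only learns the other part. -/
lemma guessMoment_le_eveAmbSK_detEncoder [DecidableEq 𝒨] [Nonempty 𝒦] {ι : Type*} [Fintype ι]
    (hρ : 0 < ρ) (hp0 : ∀ x y, 0 ≤ p x y) (v : 𝒴 → 𝒳 → ι) (σ : 𝒴 → 𝒳 → Equiv.Perm 𝒦)
    (φ : ι × 𝒦 → 𝒨) :
    (1 + Real.log (Fintype.card 𝒳)) ^ (-ρ) *
      ((∑ y, guessMoment ρ (fun x => p x y)) * (Fintype.card ι : ℝ) ^ (-ρ)) ≤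
      eveAmbSK ρ p (detEncoder fun x y k => φ (v y x, σ y x k)) := by
  have hK : (Fintype.card 𝒦 : ℝ) ≠ 0 := by exact_mod_cast Fintype.card_ne_zero
  refine le_eveAmbSK fun G hG => ?_
  rw [Finset.sum_comm, Finset.sum_mul, Finset.mul_sum]
  refine Finset.sum_le_sum fun y _ => ?_
  set b := (1 + Real.log (Fintype.card 𝒳)) ^ (-ρ) *
      (guessMoment ρ (fun x => p x y) * (Fintype.card ι : ℝ) ^ (-ρ))
  calc b = ∑ _k : 𝒦, (Fintype.card 𝒦 : ℝ)⁻¹ * b := by simp [hK]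
    _ ≤ ∑ k : 𝒦, (Fintype.card 𝒦 : ℝ)⁻¹ *
          ∑ x, p x y * (G (y, φ (v y x, k)) x : ℝ) ^ ρ := by
        refine Finset.sum_le_sum fun k _ => ?_
        gcongr
        exact guessMoment_le_of_hint hρ (fun x => hp0 x y) (g := fun i => G (y, φ (i, k)))
          (fun i => hG _) (v y)
    _ = ∑ x, ∑ k : 𝒦, p x y * (Fintype.card 𝒦 : ℝ)⁻¹ * (G (y, φ (v y x, k)) x : ℝ) ^ ρ := by
        simp only [Finset.mul_sum]
        rw [Finset.sum_comm]
        exact Finset.sum_congr rfl fun x _ => Finset.sum_congr rfl fun k _ => by ring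
    _ = _ := by
        refine Finset.sum_congr rfl fun x _ => ?_
        simp only [sum_detEncoder_mul]
        exact (Equiv.sum_comp (σ y x) fun k =>
          p x y * (Fintype.card 𝒦 : ℝ)⁻¹ * (G (y, φ (v y x, k)) x : ℝ) ^ ρ).symm

end Ambiguity

/-- Any nonempty finite set carries a one-time pad: permutations indexed by the set itself such
that the key and the ciphertext determine the plaintext. -/
lemma exists_oneTimePad (K : Type*) [Fintype K] [Nonempty K] :
    ∃ σ : K → Equiv.Perm K, ∀ k, Function.Injective fun z => σ z k := by
  have : NeZero (Fintype.card K) := ⟨Fintype.card_ne_zero⟩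
  let φ := Fintype.equivFin K
  refine ⟨fun z => (φ.trans (Equiv.addLeft (φ z))).trans φ.symm, fun k z z' h => ?_⟩
  simpa using h

/-- Theorem 12 (secret key, guessing version). -/
theorem secret_key_guessing
    {𝒳 𝒴 𝒦 𝒨 : Type*} [Fintype 𝒳] [Fintype 𝒴] [Fintype 𝒦] [Fintype 𝒨] [Nonempty 𝒦]
    (ρ : ℝ) (hρ : 0 < ρ)
    (p : 𝒳 → 𝒴 → ℝ) (hp0 : ∀ x y, 0 ≤ p x y) (hp1 : ∑ x : 𝒳, ∑ y : 𝒴, p x y = 1)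
    (hKM : Fintype.card 𝒦 ≤ Fintype.card 𝒨) :
    (∀ c : ℕ, 0 < c → c * Fintype.card 𝒦 ≤ Fintype.card 𝒨 →
      ∃ e : 𝒳 → 𝒴 → 𝒦 → 𝒨 → ℝ,
        (∀ x y k m, 0 ≤ e x y k m) ∧ (∀ x y k, ∑ m : 𝒨, e x y k m = 1) ∧
        (∀ x y k m, e x y k m = 0 ∨ e x y k m = 1) ∧
        bobGuessAmbSK ρ p e <
          1 + (2 : ℝ) ^ (ρ * (condRenyi ρ p -
            Real.logb 2 ((c * Fintype.card 𝒦 : ℕ) : ℝ) + 1)) ∧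
        (1 + Real.log (Fintype.card 𝒳)) ^ (-ρ) *
            (2 : ℝ) ^ (ρ * (condRenyi ρ p - Real.logb 2 (c : ℝ))) ≤
          eveAmbSK ρ p e) ∧
    (∀ e : 𝒳 → 𝒴 → 𝒦 → 𝒨 → ℝ,
      (∀ x y k m, 0 ≤ e x y k m) → (∀ x y k, ∑ m : 𝒨, e x y k m = 1) →
      bobGuessAmbSK ρ p e ≥
        max ((1 + Real.log (Fintype.card 𝒳)) ^ (-ρ) *
          (2 : ℝ) ^ (ρ * (condRenyi ρ p - Real.logb 2 (Fintype.card 𝒨 : ℝ)))) 1 ∧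
      eveAmbSK ρ p e ≤
        min ((Fintype.card 𝒦 : ℝ) ^ ρ * bobGuessAmbSK ρ p e)
          ((2 : ℝ) ^ (ρ * condRenyi ρ p))) := by
  classical
  have hM : 0 < Fintype.card 𝒨 := Fintype.card_pos.trans_le hKM
  have : Nonempty 𝒨 := Fintype.card_pos_iff.1 hM
  refine ⟨fun c hc hcM => ?_, fun e he he1 => ⟨max_le ?_ ?_, le_min ?_ ?_⟩⟩
  · choose g hg hgle using fun y =>
      exists_bijOn_sum_mul_rpow_le_guessMoment hρ (p := fun x => p x y) fun x => hp0 x y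
    have hn : 0 < c * Fintype.card 𝒦 := Nat.mul_pos hc Fintype.card_pos
    have hcard : Fintype.card (Fin c × 𝒦) = c * Fintype.card 𝒦 := by simp
    let ψ := Fintype.equivFinOfCardEq hcard
    obtain ⟨φ⟩ := Function.Embedding.nonempty_of_card_le (hcard.trans_le hcM)
    obtain ⟨σ, hσ⟩ := exists_oneTimePad 𝒦
    let label : 𝒴 → 𝒳 → Fin c × 𝒦 := fun y x =>
      ψ.symm ⟨(g y x - 1) % (c * Fintype.card 𝒦), Nat.mod_lt _ hn⟩
    refine ⟨detEncoder fun x y k => φ ((label y x).1, σ (label y x).2 k),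
      detEncoder_nonneg _, fun x y k => by simp [detEncoder], fun x y k m => ?_, ?_, ?_⟩
    · unfold detEncoder
      split_ifs <;> simp
    · have hn' : (0 : ℝ) < ((c * Fintype.card 𝒦 : ℕ) : ℝ) := by exact_mod_cast hn
      rw [sub_add_eq_add_sub, add_sub_assoc, two_rpow_mul_condRenyi_add hρ hp0 hp1,
        Real.rpow_sub two_pos, Real.rpow_one, Real.rpow_logb two_pos (by norm_num) hn',
        div_eq_mul_inv]
      refine bobGuessAmbSK_detEncoder_lt hρ hp0 hp1 hn hg hgle fun y k x x' h => ?_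
      have h1 := Prod.ext_iff.1 (φ.injective h)
      have h2 : label y x = label y x' := Prod.ext h1.1 (hσ k h1.2)
      exact congrArg Fin.val (ψ.symm.injective h2)
    · rw [two_rpow_mul_condRenyi_sub_logb hρ hp0 hp1 hc]
      have := guessMoment_le_eveAmbSK_detEncoder hρ hp0 (fun y x => (label y x).1)
        (fun y x => σ (label y x).2) φ
      simpa only [Fintype.card_fin] using this
  · rw [two_rpow_mul_condRenyi_sub_logb hρ hp0 hp1 hM]
    exact guessMoment_le_bobGuessAmbSK hρ hp0 he he1
  · exact one_le_bobGuessAmbSK hρ hp0 hp1 he he1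
  · exact eveAmbSK_le_card_rpow_mul_bobGuessAmbSK hρ hp0 he
  · have h := two_rpow_mul_condRenyi_add hρ hp0 hp1 0
    rw [add_zero, Real.rpow_zero, Real.one_rpow, mul_one] at h
    rw [h]
    exact eveAmbSK_le_guessMoment hρ hp0 he he1
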